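/- Let m ≥ 4 and let ℱ_m = {B_{m,m}, V_m, Λ_m}. Then: (i) for every n divisible by m, sat(n, ℱ_m) ≤ (n/m)·C(m,2); and (ii) for every n ≥ m with n not divisible by m, sat(n, ℱ_m) ≥ ((n-m)/m)·(C(m,2) + 1). -/

import Mathlib

open SimpleGraph Finset

variable {V : Type*}

/-- The graph `G` with the edge `u v` added. -/
def addEdge (G : SimpleGraph V) (u v : V) : SimpleGraph V :=
  G ⊔ SimpleGraph.fromEdgeSet {s(u, v)}

/-- `G` is `K_s`-saturated: `G` is `K_s`-free and adding any missing edge creates a `K_s`. -/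
def KSat (s : ℕ) (G : SimpleGraph V) : Prop :=
  G.CliqueFree s ∧ ∀ u v : V, u ≠ v → ¬ G.Adj u v → ¬ (addEdge G u v).CliqueFree s

/-- The number of copies of `K_r` in `G`: the number of `r`-sets of vertices inducing
a complete graph. -/
noncomputable def cliqueCount (G : SimpleGraph V) (r : ℕ) : ℕ :=
  {t : Finset V | G.IsNClique r t}.ncard

/-- `sat(n, K_r, K_s)`: minimum number of copies of `K_r` in an `n`-vertex
`K_s`-saturated graph. -/
noncomputable def satCliques (n r s : ℕ) : ℕ :=
  sInf {m | ∃ G : SimpleGraph (Fin n), KSat s G ∧ cliqueCount G r = m}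

/-- The join `K_{s-2} ∗ ∅_{n-s+2}` on `Fin n`. -/
def joinGraph (n s : ℕ) : SimpleGraph (Fin n) :=
  SimpleGraph.fromRel (fun i _ => (i : ℕ) < s - 2)

/-- The number of copies of `C_r` in `G` : the number of subgraphs of `G`
isomorphic to the cycle on `r` vertices. -/
noncomputable def cycleCount (G : SimpleGraph V) (r : ℕ) : ℕ :=
  {H : G.Subgraph | Nonempty (H.coe ≃g cycleGraph r)}.ncard

/-- `sat(n, C_r, K_s)`. -/
noncomputable def satCyclesCliqueSat (n r s : ℕ) : ℕ :=
  sInf {m | ∃ G : SimpleGraph (Fin n), KSat s G ∧ cycleCount G r = m}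

/-- `G` contains a copy of `F`, i.e. a subgraph isomorphic to `F`. -/
def ContainsCopy {α β : Type*} (F : SimpleGraph α) (G : SimpleGraph β) : Prop :=
  ∃ f : α → β, Function.Injective f ∧ ∀ a b : α, F.Adj a b → G.Adj (f a) (f b)

/-- strongly K_s-saturated -/
def StronglyKSat (s : ℕ) (G : SimpleGraph V) : Prop :=
  ∀ u v : V, u ≠ v → ¬ G.Adj u v →
    ∃ t : Finset V, (addEdge G u v).IsNClique s t ∧ u ∈ t ∧ v ∈ t

/-- dumbbell -/
def dumbbell (m : ℕ) : SimpleGraph (Fin (2 * m)) :=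
  SimpleGraph.fromRel (fun i j =>
    ((i : ℕ) < m ∧ (j : ℕ) < m) ∨ (m ≤ (i : ℕ) ∧ m ≤ (j : ℕ)) ∨ ((i : ℕ) = 0 ∧ (j : ℕ) = m))

def Vgraph (m : ℕ) : SimpleGraph (Fin (m + 2)) :=
  SimpleGraph.fromRel (fun i j =>
    ((i : ℕ) < m ∧ (j : ℕ) < m) ∨ ((i : ℕ) = 0 ∧ m ≤ (j : ℕ)))

def lambdaGraph (m : ℕ) : SimpleGraph (Fin (m + 1)) :=
  SimpleGraph.fromRel (fun i j =>
    ((i : ℕ) < m ∧ (j : ℕ) < m) ∨ ((i : ℕ) = m ∧ (j : ℕ) < 2))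

def VgraphGen (m r : ℕ) : SimpleGraph (Fin (m + (m - r))) :=
  SimpleGraph.fromRel (fun i j =>
    ((i : ℕ) < m ∧ (j : ℕ) < m) ∨
      (((i : ℕ) = 0 ∨ m ≤ (i : ℕ)) ∧ ((j : ℕ) = 0 ∨ m ≤ (j : ℕ))))

def lambdaGraphGen (m r : ℕ) : SimpleGraph (Fin (m + 1)) :=
  SimpleGraph.fromRel (fun i j =>
    ((i : ℕ) < m ∧ (j : ℕ) < m) ∨ ((i : ℕ) = m ∧ (j : ℕ) < r))

/-- `G` is saturated with respect to the family `{F₁, F₂, F₃}`. -/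
def FamSat3 {α₁ α₂ α₃ : Type*} (F₁ : SimpleGraph α₁) (F₂ : SimpleGraph α₂)
    (F₃ : SimpleGraph α₃) (G : SimpleGraph V) : Prop :=
  ¬ ContainsCopy F₁ G ∧ ¬ ContainsCopy F₂ G ∧ ¬ ContainsCopy F₃ G ∧
    ∀ u v : V, u ≠ v → ¬ G.Adj u v →
      ContainsCopy F₁ (addEdge G u v) ∨ ContainsCopy F₂ (addEdge G u v) ∨
        ContainsCopy F₃ (addEdge G u v)

noncomputable def satFam3 {α₁ α₂ α₃ : Type*} (n : ℕ) (F₁ : SimpleGraph α₁)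
    (F₂ : SimpleGraph α₂) (F₃ : SimpleGraph α₃) : ℕ :=
  sInf {m | ∃ G : SimpleGraph (Fin n), FamSat3 F₁ F₂ F₃ G ∧ G.edgeSet.ncard = m}

noncomputable def satCliquesFam3 {α₁ α₂ α₃ : Type*} (n r : ℕ) (F₁ : SimpleGraph α₁)
    (F₂ : SimpleGraph α₂) (F₃ : SimpleGraph α₃) : ℕ :=
  sInf {m | ∃ G : SimpleGraph (Fin n), FamSat3 F₁ F₂ F₃ G ∧ cliqueCount G r = m}

/-- saturation w.r.t. a single graph, with copies as subgraphs. -/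
def SatGraph {α : Type*} (F : SimpleGraph α) (G : SimpleGraph V) : Prop :=
  ¬ ContainsCopy F G ∧ ∀ u v : V, u ≠ v → ¬ G.Adj u v → ContainsCopy F (addEdge G u v)

noncomputable def satCyclesGraphSat {α : Type*} (n r : ℕ) (F : SimpleGraph α) : ℕ :=
  sInf {m | ∃ G : SimpleGraph (Fin n), SatGraph F G ∧ cycleCount G r = m}

/-- number of independent sets of size l -/
noncomputable def indepCount (G : SimpleGraph V) (l : ℕ) : ℕ :=
  {t : Finset V | t.card = l ∧ ∀ a ∈ t, ∀ b ∈ t, ¬ G.Adj a b}.ncard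

/-- Ramsey number -/
noncomputable def ramsey (l s : ℕ) : ℕ :=
  sInf {N | ∀ G : SimpleGraph (Fin N),
    (∃ t : Finset (Fin N), t.card = l ∧ ∀ a ∈ t, ∀ b ∈ t, ¬ G.Adj a b) ∨
      ∃ t : Finset (Fin N), G.IsNClique s t}

/-- The set-pairs inequality of Bollobás. -/
theorem sum_inv_choose_le_one_of_setPairs {ι α : Type*} [DecidableEq α] (X : Finset α)
    (I : Finset ι) (A B : ι → Finset α) (hA : ∀ i ∈ I, A i ⊆ X) (hB : ∀ i ∈ I, B i ⊆ X)
    (hdisj : ∀ i ∈ I, Disjoint (A i) (B i))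
    (hcross : ∀ i ∈ I, ∀ j ∈ I, i ≠ j → ¬ Disjoint (A i) (B j)) :
    ∑ i ∈ I, ((((A i).card + (B i).card).choose (B i).card : ℕ) : ℚ)⁻¹ ≤ 1 := by
  classical
  induction hN : X.card generalizing X I B with
  | zero =>
    have hX : X = ∅ := card_eq_zero.mp hN
    subst hX
    have hI : I.card ≤ 1 := by
      refine card_le_one.mpr fun i hi j hj => ?_
      by_contra hij
      refine hcross i hi j hj hij ?_
      rw [subset_empty.mp (hA i hi)]
      exact disjoint_empty_left _
    have h1 : ∀ i ∈ I, ((((A i).card + (B i).card).choose (B i).card : ℕ) : ℚ)⁻¹ ≤ 1 := by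
      intro i hi
      rw [subset_empty.mp (hA i hi), subset_empty.mp (hB i hi)]
      simp
    calc _ ≤ ∑ i ∈ I, (1 : ℚ) := sum_le_sum h1
      _ ≤ 1 := by simpa using hI
  | succ N ih =>
    by_cases hI : I.card ≤ 1
    · have h1 : ∀ i ∈ I, ((((A i).card + (B i).card).choose (B i).card : ℕ) : ℚ)⁻¹ ≤ 1 := by
        intro i hi
        apply inv_le_one_of_one_le₀
        exact_mod_cast Nat.choose_pos (Nat.le_add_left _ _)
      calc _ ≤ ∑ i ∈ I, (1 : ℚ) := sum_le_sum h1
        _ ≤ 1 := by simpa using hI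
    push Not at hI
    have hpos : ∀ i ∈ I, 0 < (B i).card := by
      intro i hi
      obtain ⟨j, hj, hji⟩ := exists_mem_ne hI i
      rw [card_pos, nonempty_iff_ne_empty]
      intro h0
      apply hcross j hj i hi hji
      simp [h0]
    have hstep : ∀ x ∈ X, ∑ i ∈ I with x ∉ A i,
        ((((A i).card + ((B i).erase x).card).choose ((B i).erase x).card : ℕ) : ℚ)⁻¹ ≤ 1 := by
      intro x hx
      apply ih (X.erase x) _ (fun i => (B i).erase x)
      · intro i hi
        rw [mem_filter] at hi
        exact subset_erase.mpr ⟨hA i hi.1, hi.2⟩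
      · intro i hi
        rw [mem_filter] at hi
        exact erase_subset_erase _ (hB i hi.1)
      · intro i hi
        rw [mem_filter] at hi
        exact (hdisj i hi.1).mono_right (erase_subset _ _)
      · intro i hi j hj hij
        rw [mem_filter] at hi hj
        have := hcross i hi.1 j hj.1 hij
        rw [not_disjoint_iff] at this ⊢
        obtain ⟨y, hy, hy'⟩ := this
        exact ⟨y, hy, mem_erase.mpr ⟨fun h => hi.2 (h ▸ hy), hy'⟩⟩
      · rw [card_erase_of_mem hx, hN]; rfl
    have hinner : ∀ i ∈ I, ∑ x ∈ X with x ∉ A i,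
        ((((A i).card + ((B i).erase x).card).choose ((B i).erase x).card : ℕ) : ℚ)⁻¹ =
        X.card * ((((A i).card + (B i).card).choose (B i).card : ℕ) : ℚ)⁻¹ := by
      intro i hi
      have hsplit : (X.filter (fun x => x ∉ A i)) = B i ∪ (X \ (A i ∪ B i)) := by
        ext x
        have h1 := @hB i hi x
        have h2 := fun hb : x ∈ B i => disjoint_right.mp (hdisj i hi) hb
        simp only [mem_filter, mem_union, mem_sdiff]
        tauto
      have hd : Disjoint (B i) (X \ (A i ∪ B i)) :=
        disjoint_sdiff.mono_left subset_union_right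
      have hcard : ((X \ (A i ∪ B i)).card : ℚ) = X.card - ((A i).card + (B i).card) := by
        rw [cast_card_sdiff (union_subset (hA i hi) (hB i hi)), card_union_of_disjoint (hdisj i hi)]
        push_cast
        ring
      rw [hsplit, sum_union hd]
      have e1 : ∑ x ∈ B i,
          ((((A i).card + ((B i).erase x).card).choose ((B i).erase x).card : ℕ) : ℚ)⁻¹ =
          (B i).card * ((((A i).card + ((B i).card - 1)).choose ((B i).card - 1) : ℕ) : ℚ)⁻¹ := by
        rw [← nsmul_eq_mul]
        apply sum_eq_card_nsmul
        intro x hx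
        rw [card_erase_of_mem hx]
      have e2 : ∑ x ∈ X \ (A i ∪ B i),
          ((((A i).card + ((B i).erase x).card).choose ((B i).erase x).card : ℕ) : ℚ)⁻¹ =
          (X \ (A i ∪ B i)).card * ((((A i).card + (B i).card).choose (B i).card : ℕ) : ℚ)⁻¹ := by
        rw [← nsmul_eq_mul]
        apply sum_eq_card_nsmul
        intro x hx
        rw [erase_eq_of_notMem]
        simp only [mem_sdiff, mem_union] at hx
        tauto
      rw [e1, e2, hcard]
      obtain ⟨b, hb⟩ : ∃ b, (B i).card = b + 1 := ⟨_, (Nat.succ_pred_eq_of_pos (hpos i hi)).symm⟩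
      rw [hb]
      generalize (A i).card = a
      have hc := Nat.add_one_mul_choose_eq (a + b) b
      have p1 : (0 : ℚ) < ((a + b).choose b : ℕ) := by
        exact_mod_cast Nat.choose_pos (Nat.le_add_left _ _)
      have p2 : (0 : ℚ) < ((a + (b + 1)).choose (b + 1) : ℕ) := by
        exact_mod_cast Nat.choose_pos (Nat.le_add_left _ _)
      have hc' : ((a : ℚ) + b + 1) * ((a + b).choose b : ℕ) =
          ((a + (b + 1)).choose (b + 1) : ℕ) * (b + 1) := by
        exact_mod_cast hc
      simp only [Nat.add_sub_cancel]
      push_cast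
      field_simp
      linear_combination -hc'
    have hsum : (X.card : ℚ) * ∑ i ∈ I,
        ((((A i).card + (B i).card).choose (B i).card : ℕ) : ℚ)⁻¹ ≤ X.card * 1 := by
      rw [mul_sum, ← sum_congr rfl hinner]
      calc _ = ∑ x ∈ X, ∑ i ∈ I with x ∉ A i,
            ((((A i).card + ((B i).erase x).card).choose ((B i).erase x).card : ℕ) : ℚ)⁻¹ := by
            apply sum_comm'
            intro i x
            simp only [mem_filter]
            tauto
        _ ≤ ∑ x ∈ X, (1 : ℚ) := sum_le_sum hstep
        _ = _ := by simp
    have hXpos : (0 : ℚ) < X.card := by rw [hN]; positivity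
    exact le_of_mul_le_mul_left hsum hXpos

/-- The unordered pairs of distinct elements of `S`. -/
def offDiagPairs {α : Type*} [DecidableEq α] (S : Finset α) : Finset (Sym2 α) :=
  S.sym2.filter fun e => ¬ e.IsDiag

theorem mk_mem_offDiagPairs {α : Type*} [DecidableEq α] {S : Finset α} {a b : α} :
    s(a, b) ∈ offDiagPairs S ↔ a ∈ S ∧ b ∈ S ∧ a ≠ b := by
  simp [offDiagPairs, and_assoc]

theorem card_offDiagPairs {α : Type*} [DecidableEq α] (S : Finset α) :
    (offDiagPairs S).card = S.card.choose 2 := by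
  rw [← Sym2.card_image_offDiag]
  congr 1
  ext e
  induction e with
  | h a b =>
    rw [mk_mem_offDiagPairs]
    simp only [mem_image, mem_offDiag, Prod.exists, Function.uncurry_apply_pair, Sym2.eq_iff]
    constructor
    · rintro ⟨ha, hb, hab⟩
      exact ⟨a, b, ⟨ha, hb, hab⟩, Or.inl ⟨rfl, rfl⟩⟩
    · rintro ⟨c, d, ⟨hc, hd, hcd⟩, ⟨rfl, rfl⟩ | ⟨rfl, rfl⟩⟩
      · exact ⟨hc, hd, hcd⟩
      · exact ⟨hd, hc, hcd.symm⟩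

/-- If every nonadjacent pair in `R` has an `m - 2`-clique of common neighbours inside `R`, then
`G` has at most `(#R - m + 2).choose 2` nonadjacent pairs in `R`. -/
theorem card_nonadjacent_pairs_le [DecidableEq V] (G : SimpleGraph V) (m : ℕ) (R : Finset V)
    (h : ∀ u ∈ R, ∀ v ∈ R, u ≠ v → ¬ G.Adj u v →
      ∃ t : Finset V, t ⊆ R ∧ t.card = m ∧ u ∈ t ∧ v ∈ t ∧
        ∀ a ∈ t, ∀ b ∈ t, a ≠ b → s(a, b) ≠ s(u, v) → G.Adj a b)
    (P : Finset (Sym2 V)) (hP : P ⊆ offDiagPairs R) (hPG : ∀ e ∈ P, e ∉ G.edgeSet) :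
    P.card ≤ (R.card - m + 2).choose 2 := by
  classical
  have h' : ∀ e : Sym2 V, ∃ t : Finset V, e ∈ P → t ⊆ R ∧ t.card = m ∧ e.toFinset ⊆ t ∧
      ∀ a ∈ t, ∀ b ∈ t, a ≠ b → s(a, b) ≠ e → G.Adj a b := by
    intro e
    by_cases he : e ∈ P
    · induction e with
      | h u v =>
        obtain ⟨hu, hv, huv⟩ := mk_mem_offDiagPairs.mp (hP he)
        obtain ⟨t, h1, h2, h3, h4, h5⟩ := h u hu v hv huv (hPG _ he)
        refine ⟨t, fun _ => ⟨h1, h2, ?_, h5⟩⟩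
        rw [Sym2.toFinset_mk_eq]
        exact insert_subset h3 (singleton_subset_iff.mpr h4)
    · exact ⟨∅, fun h => absurd h he⟩
  choose t ht using h'
  have hcardA : ∀ e ∈ P, e.toFinset.card = 2 := fun e he =>
    Sym2.card_toFinset_of_not_isDiag e (mem_filter.mp (hP he)).2
  have hcardB : ∀ e ∈ P, (R \ t e).card = R.card - m := fun e he => by
    rw [card_sdiff_of_subset (ht e he).1, (ht e he).2.1]
  have key := sum_inv_choose_le_one_of_setPairs R P (fun e => e.toFinset) (fun e => R \ t e)
    (fun e he => (ht e he).2.2.1.trans (ht e he).1) (fun e _ => sdiff_subset)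
    (fun e he => disjoint_sdiff.mono_left (ht e he).2.2.1)
    (by
      intro e he f hf hef hd
      induction e with
      | h a b =>
        obtain ⟨ha, hb, hab⟩ := mk_mem_offDiagPairs.mp (hP he)
        rw [Sym2.toFinset_mk_eq] at hd
        simp only [disjoint_insert_left, disjoint_singleton_left, mem_sdiff, not_and, not_not] at hd
        exact hPG _ he ((ht f hf).2.2.2 a (hd.1 ha) b (hd.2 hb) hab hef))
  rw [sum_congr rfl (g := fun _ => (((R.card - m + 2).choose 2 : ℕ) : ℚ)⁻¹)] at key
  · rw [sum_const, nsmul_eq_mul, ← div_eq_mul_inv, div_le_one] at key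
    · exact_mod_cast key
    · exact_mod_cast Nat.choose_pos (by omega)
  · intro e he
    rw [hcardA e he, hcardB e he, Nat.add_comm 2, Nat.choose_symm_add]

theorem exists_enum_of_card_eq {α : Type*} {m : ℕ} {K : Finset α} (hm : 2 ≤ m) (hK : K.card = m)
    {x x' : α} (hx : x ∈ K) (hx' : x' ∈ K) (hne : x ≠ x') :
    ∃ g : Fin m → α, Function.Injective g ∧ (∀ i, g i ∈ K) ∧
      g ⟨0, by omega⟩ = x ∧ g ⟨1, by omega⟩ = x' := by
  classical
  let e : Fin m ≃ K := (K.equivFinOfCardEq hK).symm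
  let a := e.symm ⟨x, hx⟩
  let b := e.symm ⟨x', hx'⟩
  have hab : a ≠ b := fun h => hne (congrArg Subtype.val (e.symm.injective h))
  let i₀ : Fin m := ⟨0, by omega⟩
  let i₁ : Fin m := ⟨1, by omega⟩
  have h01 : i₀ ≠ i₁ := by simp [i₀, i₁]
  let c := Equiv.swap i₀ a i₁
  have hac : a ≠ c := by
    intro h
    apply h01
    apply (Equiv.swap i₀ a).injective
    rw [Equiv.swap_apply_left]
    exact h
  refine ⟨fun i => (e (Equiv.swap c b (Equiv.swap i₀ a i)) : α), ?_, ?_, ?_, ?_⟩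
  · exact Subtype.val_injective.comp (e.injective.comp
      ((Equiv.swap c b).injective.comp (Equiv.swap i₀ a).injective))
  · intro i
    exact Subtype.property _
  · change (e (Equiv.swap c b (Equiv.swap i₀ a i₀)) : α) = x
    rw [Equiv.swap_apply_left, Equiv.swap_apply_of_ne_of_ne hac hab]
    simp [a]
  · change (e (Equiv.swap c b c) : α) = x'
    rw [Equiv.swap_apply_left]
    simp [b]

theorem isNClique_map_univ {m : ℕ} (H : SimpleGraph V) (g : Fin m ↪ V)
    (h : ∀ i j, i ≠ j → H.Adj (g i) (g j)) : H.IsNClique m (univ.map g) := by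
  refine ⟨?_, by simp⟩
  intro a ha b hb hab
  simp only [coe_map, coe_univ, Set.image_univ, Set.mem_range] at ha hb
  obtain ⟨i, rfl⟩ := ha
  obtain ⟨j, rfl⟩ := hb
  exact h i j (fun h => hab (h ▸ rfl))

theorem containsCopy_Vgraph_iff {m : ℕ} (hm : 2 ≤ m) (H : SimpleGraph V) :
    ContainsCopy (Vgraph m) H ↔ ∃ (K : Finset V) (x y z : V), H.IsNClique m K ∧ x ∈ K ∧ y ∉ K ∧
      z ∉ K ∧ y ≠ z ∧ H.Adj x y ∧ H.Adj x z := by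
  constructor
  · rintro ⟨f, hf, hadj⟩
    let g : Fin m ↪ V := ⟨fun i => f (i.castLE (by omega)), fun i j h => by
      have := hf h; simpa [Fin.ext_iff] using this⟩
    have hnot : ∀ k : Fin (m + 2), m ≤ (k : ℕ) → f k ∉ univ.map g := by
      intro k hk hmem
      simp only [mem_map, mem_univ, true_and] at hmem
      obtain ⟨i, hi⟩ := hmem
      have := congrArg Fin.val (hf hi)
      simp at this
      omega
    refine ⟨univ.map g, f ⟨0, by omega⟩, f ⟨m, by omega⟩, f ⟨m + 1, by omega⟩,
      isNClique_map_univ H g ?_, ?_, hnot _ le_rfl, hnot _ (by simp), ?_, ?_, ?_⟩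
    · intro i j hij
      apply hadj
      simp only [Vgraph, fromRel_adj]
      simp [Fin.ext_iff] at hij ⊢
      omega
    · exact mem_map.mpr ⟨⟨0, by omega⟩, mem_univ _, rfl⟩
    · intro h
      have := hf h
      simp at this
    · apply hadj
      rw [Vgraph, fromRel_adj]
      simp only [ne_eq, Fin.mk.injEq, true_and]
      omega
    · apply hadj
      rw [Vgraph, fromRel_adj]
      simp only [ne_eq, Fin.mk.injEq, true_and]
      omega
  · rintro ⟨K, x, y, z, hK, hx, hy, hz, hyz, hxy, hxz⟩
    obtain ⟨x', hx', hne⟩ := exists_mem_ne (by rw [hK.card_eq]; omega) x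
    obtain ⟨g, hg, hgK, hg0, -⟩ := exists_enum_of_card_eq hm hK.card_eq hx hx' hne.symm
    have hgy : ∀ i, g i ≠ y := fun i h => hy (h ▸ hgK i)
    have hgz : ∀ i, g i ≠ z := fun i h => hz (h ▸ hgK i)
    refine ⟨fun i => if h : (i : ℕ) < m then g ⟨i, h⟩ else if (i : ℕ) = m then y else z, ?_, ?_⟩
    · intro i j hij
      have hi := i.2
      have hj := j.2
      simp only at hij
      ext
      split_ifs at hij <;> first
        | omega
        | exact absurd hij (hgy _)
        | exact absurd hij (hgz _)
        | exact absurd hij.symm (hgy _)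
        | exact absurd hij.symm (hgz _)
        | exact absurd hij hyz
        | exact absurd hij.symm hyz
        | simpa using hg hij
    · have hc : ∀ i j (hi : i < m) (hj : j < m), i ≠ j → H.Adj (g ⟨i, hi⟩) (g ⟨j, hj⟩) := by
        intro i j hi hj hij
        exact hK.1 (hgK _) (hgK _) (fun h => hij (by simpa using hg h))
      have h0 : ∀ j : Fin (m + 2), ¬ (j : ℕ) < m → H.Adj x (if (j : ℕ) = m then y else z) := by
        intro j _
        split_ifs
        · exact hxy
        · exact hxz
      have hs : ∀ i j : Fin (m + 2), i ≠ j →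
          (((i : ℕ) < m ∧ (j : ℕ) < m) ∨ ((i : ℕ) = 0 ∧ m ≤ (j : ℕ))) →
          H.Adj (if h : (i : ℕ) < m then g ⟨i, h⟩ else if (i : ℕ) = m then y else z)
            (if h : (j : ℕ) < m then g ⟨j, h⟩ else if (j : ℕ) = m then y else z) := by
        rintro i j hij (⟨hi, hj⟩ | ⟨hi, hj⟩)
        · rw [dif_pos hi, dif_pos hj]
          exact hc _ _ _ _ (fun h => hij (Fin.ext h))
        · rw [dif_pos (by omega), dif_neg (by omega)]
          simp only [hi]
          rw [hg0]
          exact h0 j (by omega)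
      intro i j hij
      rw [Vgraph, fromRel_adj] at hij
      rcases hij.2 with h | h
      · exact hs i j hij.1 h
      · exact (hs j i hij.1.symm h).symm

theorem containsCopy_lambdaGraph_iff {m : ℕ} (hm : 2 ≤ m) (H : SimpleGraph V) :
    ContainsCopy (lambdaGraph m) H ↔ ∃ (K : Finset V) (x x' y : V), H.IsNClique m K ∧ x ∈ K ∧
      x' ∈ K ∧ x ≠ x' ∧ y ∉ K ∧ H.Adj y x ∧ H.Adj y x' := by
  constructor
  · rintro ⟨f, hf, hadj⟩
    let g : Fin m ↪ V := ⟨fun i => f (i.castLE (by omega)), fun i j h => by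
      have := hf h; simpa [Fin.ext_iff] using this⟩
    refine ⟨univ.map g, f ⟨0, by omega⟩, f ⟨1, by omega⟩, f ⟨m, by omega⟩,
      isNClique_map_univ H g ?_, ?_, ?_, ?_, ?_, ?_, ?_⟩
    · intro i j hij
      apply hadj
      simp only [lambdaGraph, fromRel_adj]
      simp [Fin.ext_iff] at hij ⊢
      omega
    · exact mem_map.mpr ⟨⟨0, by omega⟩, mem_univ _, rfl⟩
    · exact mem_map.mpr ⟨⟨1, by omega⟩, mem_univ _, rfl⟩
    · intro h
      have := hf h
      simp at this
    · intro hmem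
      simp only [mem_map, mem_univ, true_and] at hmem
      obtain ⟨i, hi⟩ := hmem
      have := congrArg Fin.val (hf hi)
      simp at this
      omega
    · apply hadj
      rw [lambdaGraph, fromRel_adj]
      simp only [ne_eq, Fin.mk.injEq, true_and]
      omega
    · apply hadj
      rw [lambdaGraph, fromRel_adj]
      simp only [ne_eq, Fin.mk.injEq, true_and]
      omega
  · rintro ⟨K, x, x', y, hK, hx, hx', hne, hy, hyx, hyx'⟩
    obtain ⟨g, hg, hgK, hg0, hg1⟩ := exists_enum_of_card_eq hm hK.card_eq hx hx' hne
    have hgy : ∀ i, g i ≠ y := fun i h => hy (h ▸ hgK i)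
    refine ⟨fun i => if h : (i : ℕ) < m then g ⟨i, h⟩ else y, ?_, ?_⟩
    · intro i j hij
      have hi := i.2
      have hj := j.2
      simp only at hij
      ext
      split_ifs at hij <;> first
        | omega
        | exact absurd hij (hgy _)
        | exact absurd hij.symm (hgy _)
        | simpa using hg hij
    · have hs : ∀ i j : Fin (m + 1), i ≠ j →
          (((i : ℕ) < m ∧ (j : ℕ) < m) ∨ ((i : ℕ) = m ∧ (j : ℕ) < 2)) →
          H.Adj (if h : (i : ℕ) < m then g ⟨i, h⟩ else y)
            (if h : (j : ℕ) < m then g ⟨j, h⟩ else y) := by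
        rintro i j hij (⟨hi, hj⟩ | ⟨hi, hj⟩)
        · rw [dif_pos hi, dif_pos hj]
          exact hK.1 (hgK _) (hgK _) (fun h => hij (Fin.ext (by simpa using hg h)))
        · rw [dif_neg (by omega), dif_pos (by omega)]
          obtain h | h : (j : ℕ) = 0 ∨ (j : ℕ) = 1 := by omega
          · simp only [h]
            rwa [hg0]
          · simp only [h]
            rwa [hg1]
      intro i j hij
      rw [lambdaGraph, fromRel_adj] at hij
      rcases hij.2 with h | h
      · exact hs i j hij.1 h
      · exact (hs j i hij.1.symm h).symm

theorem containsCopy_dumbbell_iff {m : ℕ} (hm : 2 ≤ m) (H : SimpleGraph V) :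
    ContainsCopy (dumbbell m) H ↔ ∃ (K K' : Finset V) (x x' : V), H.IsNClique m K ∧
      H.IsNClique m K' ∧ Disjoint K K' ∧ x ∈ K ∧ x' ∈ K' ∧ H.Adj x x' := by
  constructor
  · rintro ⟨f, hf, hadj⟩
    let g : Fin m ↪ V := ⟨fun i => f (i.castLE (by omega)), fun i j h => by
      have := hf h; simpa [Fin.ext_iff] using this⟩
    let g' : Fin m ↪ V := ⟨fun i => f ⟨m + i, by omega⟩, fun i j h => by
      have := hf h; simpa [Fin.ext_iff] using this⟩
    refine ⟨univ.map g, univ.map g', f ⟨0, by omega⟩, f ⟨m, by omega⟩,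
      isNClique_map_univ H g ?_, isNClique_map_univ H g' ?_, ?_, ?_, ?_, ?_⟩
    · intro i j hij
      apply hadj
      simp only [dumbbell, fromRel_adj]
      simp [Fin.ext_iff] at hij ⊢
      omega
    · intro i j hij
      apply hadj
      simp only [dumbbell, fromRel_adj]
      simp [Fin.ext_iff] at hij ⊢
      omega
    · rw [Finset.disjoint_left]
      intro a ha hb
      simp only [mem_map, mem_univ, true_and] at ha hb
      obtain ⟨i, rfl⟩ := ha
      obtain ⟨j, hj⟩ := hb
      have := congrArg Fin.val (hf hj)
      simp at this
      omega
    · exact mem_map.mpr ⟨⟨0, by omega⟩, mem_univ _, rfl⟩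
    · exact mem_map.mpr ⟨⟨0, by omega⟩, mem_univ _, rfl⟩
    · apply hadj
      rw [dumbbell, fromRel_adj]
      simp only [ne_eq, Fin.mk.injEq, or_true, true_or, and_true]
      omega
  · rintro ⟨K, K', x, x', hK, hK', hd, hx, hx', hadj⟩
    obtain ⟨y, hy, hne⟩ := exists_mem_ne (by rw [hK.card_eq]; omega) x
    obtain ⟨y', hy', hne'⟩ := exists_mem_ne (by rw [hK'.card_eq]; omega) x'
    obtain ⟨g, hg, hgK, hg0, -⟩ := exists_enum_of_card_eq hm hK.card_eq hx hy hne.symm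
    obtain ⟨g', hg', hgK', hg0', -⟩ := exists_enum_of_card_eq hm hK'.card_eq hx' hy' hne'.symm
    have hgg : ∀ i j, g i ≠ g' j := fun i j h => Finset.disjoint_left.mp hd (hgK i) (h ▸ hgK' j)
    refine ⟨fun i => if h : (i : ℕ) < m then g ⟨i, h⟩ else g' ⟨i - m, by omega⟩, ?_, ?_⟩
    · intro i j hij
      have hi := i.2
      have hj := j.2
      simp only at hij
      ext
      split_ifs at hij
      · simpa using hg hij
      · exact absurd hij (hgg _ _)
      · exact absurd hij.symm (hgg _ _)
      · have := hg' hij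
        simp only [Fin.mk.injEq] at this
        omega
    · have hs : ∀ i j : Fin (2 * m), i ≠ j →
          (((i : ℕ) < m ∧ (j : ℕ) < m) ∨ (m ≤ (i : ℕ) ∧ m ≤ (j : ℕ)) ∨
            ((i : ℕ) = 0 ∧ (j : ℕ) = m)) →
          H.Adj (if h : (i : ℕ) < m then g ⟨i, h⟩ else g' ⟨i - m, by omega⟩)
            (if h : (j : ℕ) < m then g ⟨j, h⟩ else g' ⟨j - m, by omega⟩) := by
        rintro i j hij (⟨hi, hj⟩ | ⟨hi, hj⟩ | ⟨hi, hj⟩)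
        · rw [dif_pos hi, dif_pos hj]
          exact hK.1 (hgK _) (hgK _) (fun h => hij (Fin.ext (by simpa using hg h)))
        · rw [dif_neg (by omega), dif_neg (by omega)]
          refine hK'.1 (hgK' _) (hgK' _) (fun h => hij (Fin.ext ?_))
          have := hg' h
          simp only [Fin.mk.injEq] at this
          omega
        · rw [dif_pos (by omega), dif_neg (by omega)]
          simp only [hi, hj, Nat.sub_self]
          rwa [hg0, hg0']
      intro i j hij
      rw [dumbbell, fromRel_adj] at hij
      rcases hij.2 with h | h
      · exact hs i j hij.1 h
      · exact (hs j i hij.1.symm h).symm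

theorem addEdge_adj {G : SimpleGraph V} {u v a b : V} :
    (addEdge G u v).Adj a b ↔ G.Adj a b ∨ (s(a, b) = s(u, v) ∧ a ≠ b) := by
  simp [addEdge]

/-- The local form of containing none of `dumbbell m`, `Vgraph m` and `lambdaGraph m`. -/
structure FamFree (m : ℕ) (G : SimpleGraph V) : Prop where
  eq_of_adj_left : ∀ {K : Finset V} {x x' y : V}, G.IsNClique m K → x ∈ K → x' ∈ K → y ∉ K →
    G.Adj y x → G.Adj y x' → x = x'
  eq_of_adj_right : ∀ {K : Finset V} {x y z : V}, G.IsNClique m K → x ∈ K → y ∉ K → z ∉ K →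
    G.Adj x y → G.Adj x z → y = z
  not_adj : ∀ {K K' : Finset V} {x x' : V}, G.IsNClique m K → G.IsNClique m K' → Disjoint K K' →
    x ∈ K → x' ∈ K' → ¬ G.Adj x x'

theorem famFree_iff {m : ℕ} (hm : 2 ≤ m) (G : SimpleGraph V) :
    FamFree m G ↔ ¬ ContainsCopy (dumbbell m) G ∧ ¬ ContainsCopy (Vgraph m) G ∧
      ¬ ContainsCopy (lambdaGraph m) G := by
  rw [containsCopy_dumbbell_iff hm, containsCopy_Vgraph_iff hm, containsCopy_lambdaGraph_iff hm]
  constructor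
  · intro h
    refine ⟨?_, ?_, ?_⟩
    · rintro ⟨K, K', x, x', hK, hK', hd, hx, hx', hadj⟩
      exact h.not_adj hK hK' hd hx hx' hadj
    · rintro ⟨K, x, y, z, hK, hx, hy, hz, hyz, hxy, hxz⟩
      exact hyz (h.eq_of_adj_right hK hx hy hz hxy hxz)
    · rintro ⟨K, x, x', y, hK, hx, hx', hne, hy, hyx, hyx'⟩
      exact hne (h.eq_of_adj_left hK hx hx' hy hyx hyx')
  · rintro ⟨hB, hV, hL⟩
    refine ⟨?_, ?_, ?_⟩
    · intro K x x' y hK hx hx' hy hyx hyx'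
      by_contra hne
      exact hL ⟨K, x, x', y, hK, hx, hx', hne, hy, hyx, hyx'⟩
    · intro K x y z hK hx hy hz hxy hxz
      by_contra hyz
      exact hV ⟨K, x, y, z, hK, hx, hy, hz, hyz, hxy, hxz⟩
    · intro K K' x x' hK hK' hd hx hx' hadj
      exact hB ⟨K, K', x, x', hK, hK', hd, hx, hx', hadj⟩

theorem FamFree.eq_of_mem {m : ℕ} (hm : 3 ≤ m) {G : SimpleGraph V} (h : FamFree m G)
    {K K' : Finset V} (hK : G.IsNClique m K) (hK' : G.IsNClique m K') {v : V} (hv : v ∈ K)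
    (hv' : v ∈ K') : K = K' := by
  classical
  by_contra hne
  have hsub : ¬ K' ⊆ K := fun hs =>
    hne (eq_of_subset_of_card_le hs (by rw [hK.card_eq, hK'.card_eq])).symm
  obtain ⟨y, hy, hyK⟩ := not_subset.mp hsub
  have hyv : y ≠ v := fun e => hyK (e ▸ hv)
  have hlt : 2 < K'.card := by rw [hK'.card_eq]; omega
  obtain ⟨z, hz, hzv, hzy⟩ : ∃ z ∈ K', z ≠ v ∧ z ≠ y := by
    have : ({v, y} : Finset V).card < K'.card := lt_of_le_of_lt card_le_two hlt
    obtain ⟨z, hz, hz'⟩ := exists_mem_notMem_of_card_lt_card this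
    simp only [mem_insert, mem_singleton, not_or] at hz'
    exact ⟨z, hz, hz'⟩
  by_cases hzK : z ∈ K
  · exact hzv (h.eq_of_adj_left hK hzK hv hyK (hK'.1 hy hz hzy.symm) (hK'.1 hy hv' hyv))
  · exact hzy (h.eq_of_adj_right hK hv hzK hyK (hK'.1 hv' hz hzv.symm) (hK'.1 hv' hy hyv.symm))

theorem isNClique_of_addEdge {m : ℕ} {G : SimpleGraph V} {u v : V} {K : Finset V}
    (hK : (addEdge G u v).IsNClique m K) (h : ¬ (u ∈ K ∧ v ∈ K)) : G.IsNClique m K := by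
  refine ⟨fun a ha b hb hab => ?_, hK.card_eq⟩
  rcases addEdge_adj.mp (hK.1 ha hb hab) with h' | ⟨h', -⟩
  · exact h'
  · rcases Sym2.eq_iff.mp h' with ⟨rfl, rfl⟩ | ⟨rfl, rfl⟩
    · exact absurd ⟨ha, hb⟩ h
    · exact absurd ⟨hb, ha⟩ h

/-- The edge `a b` leaves the `m`-clique `K` of `G` and may complete a forbidden graph on `K`. -/
def IsCriticalAt (m : ℕ) (G : SimpleGraph V) (K : Finset V) (a b : V) : Prop :=
  a ∈ K ∧ b ∉ K ∧ ((∃ z, z ∉ K ∧ G.Adj a z) ∨ (∃ x ∈ K, G.Adj b x) ∨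
    ∃ K' : Finset V, G.IsNClique m K' ∧ b ∈ K')

theorem FamSat3.exists_clique_or_isCriticalAt {m : ℕ} (hm : 2 ≤ m) {G : SimpleGraph V}
    (hG : FamSat3 (dumbbell m) (Vgraph m) (lambdaGraph m) G) {u v : V} (huv : u ≠ v)
    (hadj : ¬ G.Adj u v) :
    (∃ t : Finset V, (addEdge G u v).IsNClique m t ∧ u ∈ t ∧ v ∈ t) ∨
      ∃ K : Finset V, G.IsNClique m K ∧ (IsCriticalAt m G K u v ∨ IsCriticalAt m G K v u) := by
  have hfree : FamFree m G := (famFree_iff hm G).mpr ⟨hG.1, hG.2.1, hG.2.2.1⟩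
  rw [or_iff_not_imp_left]
  intro hno
  have hcl : ∀ {K : Finset V}, (addEdge G u v).IsNClique m K → G.IsNClique m K := fun hK =>
    isNClique_of_addEdge hK fun h => hno ⟨_, hK, h⟩
  rcases hG.2.2.2 u v huv hadj with h | h | h
  · obtain ⟨K, K', x, x', hK, hK', hd, hx, hx', h⟩ := (containsCopy_dumbbell_iff hm _).mp h
    replace hK := hcl hK
    replace hK' := hcl hK'
    have hx'K : x' ∉ K := fun h => Finset.disjoint_left.mp hd h hx'
    rcases addEdge_adj.mp h with h | ⟨h, -⟩
    · exact absurd h (hfree.not_adj hK hK' hd hx hx')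
    · rcases Sym2.eq_iff.mp h with ⟨rfl, rfl⟩ | ⟨rfl, rfl⟩
      · exact ⟨K, hK, Or.inl ⟨hx, hx'K, Or.inr (Or.inr ⟨K', hK', hx'⟩)⟩⟩
      · exact ⟨K, hK, Or.inr ⟨hx, hx'K, Or.inr (Or.inr ⟨K', hK', hx'⟩)⟩⟩
  · obtain ⟨K, x, y, z, hK, hx, hy, hz, hyz, hxy, hxz⟩ := (containsCopy_Vgraph_iff hm _).mp h
    replace hK := hcl hK
    have key : ∀ {y z : V}, y ∉ K → z ∉ K → y ≠ z → (addEdge G u v).Adj x z → s(x, y) = s(u, v) →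
        IsCriticalAt m G K u v ∨ IsCriticalAt m G K v u := by
      intro y z hy hz hyz hxz h
      have hxz' : G.Adj x z := by
        rcases addEdge_adj.mp hxz with h' | ⟨h', -⟩
        · exact h'
        · exact absurd (Sym2.congr_right.mp (h.trans h'.symm)) hyz
      rcases Sym2.eq_iff.mp h with ⟨rfl, rfl⟩ | ⟨rfl, rfl⟩
      · exact Or.inl ⟨hx, hy, Or.inl ⟨z, hz, hxz'⟩⟩
      · exact Or.inr ⟨hx, hy, Or.inl ⟨z, hz, hxz'⟩⟩
    refine ⟨K, hK, ?_⟩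
    rcases addEdge_adj.mp hxy with h | ⟨h, -⟩
    · rcases addEdge_adj.mp hxz with h' | ⟨h', -⟩
      · exact absurd (hfree.eq_of_adj_right hK hx hy hz h h') hyz
      · exact key hz hy hyz.symm hxy h'
    · exact key hy hz hyz hxz h
  · obtain ⟨K, x, x', y, hK, hx, hx', hne, hy, hyx, hyx'⟩ :=
      (containsCopy_lambdaGraph_iff hm _).mp h
    replace hK := hcl hK
    have key : ∀ {x x' : V}, x ∈ K → x' ∈ K → x ≠ x' → (addEdge G u v).Adj y x' →
        s(y, x) = s(u, v) → IsCriticalAt m G K u v ∨ IsCriticalAt m G K v u := by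
      intro x x' hx hx' hne hyx' h
      have hyx'' : G.Adj y x' := by
        rcases addEdge_adj.mp hyx' with h' | ⟨h', -⟩
        · exact h'
        · exact absurd (Sym2.congr_right.mp (h.trans h'.symm)) hne
      rcases Sym2.eq_iff.mp h with ⟨rfl, rfl⟩ | ⟨rfl, rfl⟩
      · exact Or.inr ⟨hx, hy, Or.inr (Or.inl ⟨x', hx', hyx''⟩)⟩
      · exact Or.inl ⟨hx, hy, Or.inr (Or.inl ⟨x', hx', hyx''⟩)⟩
    refine ⟨K, hK, ?_⟩
    rcases addEdge_adj.mp hyx with h | ⟨h, -⟩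
    · rcases addEdge_adj.mp hyx' with h' | ⟨h', -⟩
      · exact absurd (hfree.eq_of_adj_left hK hx hx' hy h h') hne
      · exact key hx' hx hne.symm hyx h'
    · exact key hx hx' hne hyx' h

/-- If some vertex lies in no `m`-clique, then every `m`-clique is joined to its complement. -/
theorem FamSat3.exists_adj_notMem {m : ℕ} (hm : 4 ≤ m) {G : SimpleGraph V}
    (hG : FamSat3 (dumbbell m) (Vgraph m) (lambdaGraph m) G) {v : V}
    (hv : ∀ K : Finset V, G.IsNClique m K → v ∉ K) {K : Finset V} (hK : G.IsNClique m K) :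
    ∃ x ∈ K, ∃ y, y ∉ K ∧ G.Adj x y := by
  classical
  have hfree : FamFree m G := (famFree_iff (by omega) G).mpr ⟨hG.1, hG.2.1, hG.2.2.1⟩
  by_contra! hno
  obtain ⟨u, hu⟩ : K.Nonempty := card_pos.mp (by rw [hK.card_eq]; omega)
  have hvK := hv K hK
  have huv : u ≠ v := fun h => hvK (h ▸ hu)
  rcases hG.exists_clique_or_isCriticalAt (by omega) huv (hno u hu v hvK) with
    ⟨t, ht, hut, hvt⟩ | ⟨K', hK', ⟨huK', -, h⟩ | ⟨hvK', -⟩⟩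
  · have hlt : ({u, v} : Finset V).card < t.card := by
      rw [ht.card_eq]
      exact lt_of_le_of_lt card_le_two (by omega)
    obtain ⟨w, hw, hw'⟩ := exists_mem_notMem_of_card_lt_card hlt
    simp only [mem_insert, mem_singleton, not_or] at hw'
    have hne : ∀ a, s(w, a) ≠ s(u, v) := by
      intro a h
      rcases Sym2.eq_iff.mp h with ⟨h, -⟩ | ⟨h, -⟩
      · exact hw'.1 h
      · exact hw'.2 h
    have hwu : G.Adj w u :=
      (addEdge_adj.mp (ht.1 hw hut hw'.1)).resolve_right fun h => hne u h.1
    have hwv : G.Adj w v :=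
      (addEdge_adj.mp (ht.1 hw hvt hw'.2)).resolve_right fun h => hne v h.1
    have hwK : w ∈ K := by
      by_contra h
      exact hno u hu w h hwu.symm
    exact hno w hwK v hvK hwv
  · obtain rfl := hfree.eq_of_mem (by omega) hK hK' hu huK'
    rcases h with ⟨z, hz, h⟩ | ⟨x, hx, h⟩ | ⟨K', hK', h⟩
    · exact hno u hu z hz h
    · exact hno x hx v hvK h.symm
    · exact hv K' hK' h
  · exact hv K' hK' hvK'

/-- Outside the `m`-cliques, a saturated graph is `K_m`-saturated. -/
theorem FamSat3.exists_near_clique {m : ℕ} (hm : 2 ≤ m) {G : SimpleGraph V}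
    (hG : FamSat3 (dumbbell m) (Vgraph m) (lambdaGraph m) G) {u v : V}
    (hu : ∀ K : Finset V, G.IsNClique m K → u ∉ K) (hv : ∀ K : Finset V, G.IsNClique m K → v ∉ K)
    (huv : u ≠ v) (hadj : ¬ G.Adj u v) :
    ∃ t : Finset V, (∀ w ∈ t, ∀ K : Finset V, G.IsNClique m K → w ∉ K) ∧ t.card = m ∧ u ∈ t ∧
      v ∈ t ∧ ∀ a ∈ t, ∀ b ∈ t, a ≠ b → s(a, b) ≠ s(u, v) → G.Adj a b := by
  have hfree : FamFree m G := (famFree_iff hm G).mpr ⟨hG.1, hG.2.1, hG.2.2.1⟩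
  rcases hG.exists_clique_or_isCriticalAt hm huv hadj with
    ⟨t, ht, hut, hvt⟩ | ⟨K, hK, ⟨h, -⟩ | ⟨h, -⟩⟩
  · have hadj' : ∀ a ∈ t, ∀ b ∈ t, a ≠ b → s(a, b) ≠ s(u, v) → G.Adj a b := by
      intro a ha b hb hab hne
      rcases addEdge_adj.mp (ht.1 ha hb hab) with h | ⟨h, -⟩
      · exact h
      · exact absurd h hne
    refine ⟨t, ?_, ht.card_eq, hut, hvt, hadj'⟩
    intro w hw K hK hwK
    have hwu : w ≠ u := fun h => hu K hK (h ▸ hwK)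
    have hwv : w ≠ v := fun h => hv K hK (h ▸ hwK)
    refine huv (hfree.eq_of_adj_right hK hwK (hu K hK) (hv K hK)
      (hadj' w hw u hut hwu ?_) (hadj' w hw v hvt hwv ?_))
    all_goals
      intro h
      rcases Sym2.eq_iff.mp h with ⟨h, -⟩ | ⟨h, -⟩
      · exact hwu h
      · exact hwv h
  · exact absurd h (hu K hK)
  · exact absurd h (hv K hK)

theorem FamSat3.edge_lower_bound [Fintype V] {m : ℕ} (hm : 4 ≤ m) {G : SimpleGraph V}
    (hG : FamSat3 (dumbbell m) (Vgraph m) (lambdaGraph m) G) (hdvd : ¬ m ∣ Fintype.card V) :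
    ∃ k r : ℕ, Fintype.card V = k * m + r ∧ k * (m.choose 2 + 1) ≤ G.edgeSet.ncard ∧
      (m ≤ r → k * (m.choose 2 + 1) + r.choose 2 ≤ G.edgeSet.ncard + (r - m + 2).choose 2) := by
  classical
  have hfree : FamFree m G := (famFree_iff (by omega) G).mpr ⟨hG.1, hG.2.1, hG.2.2.1⟩
  let C : Finset (Finset V) := {K | G.IsNClique m K}
  let R : Finset V := {v | ∀ K : Finset V, G.IsNClique m K → v ∉ K}
  have memC : ∀ {K}, K ∈ C ↔ G.IsNClique m K := by simp [C]
  have memR : ∀ {v}, v ∈ R ↔ ∀ K : Finset V, G.IsNClique m K → v ∉ K := by simp [R]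
  have hCdisj : (C : Set (Finset V)).PairwiseDisjoint id := by
    intro K hK K' hK' hne
    rw [Function.onFun, Finset.disjoint_left]
    intro v hv hv'
    exact hne (hfree.eq_of_mem (by omega) (memC.mp hK) (memC.mp hK') hv hv')
  have hcardV : Fintype.card V = C.card * m + R.card := by
    have hR : R = univ \ C.biUnion id := by
      ext v
      simp [R, C]
    have h1 : (C.biUnion id).card = C.card * m := by
      rw [card_biUnion hCdisj]
      exact sum_const_nat fun K hK => (memC.mp hK).card_eq
    have h2 := card_sdiff_add_card_eq_card (subset_univ (C.biUnion id))
    rw [← hR, h1, card_univ] at h2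
    omega
  obtain ⟨v₀, hv₀⟩ : R.Nonempty := by
    rw [nonempty_iff_ne_empty]
    intro h
    apply hdvd
    rw [hcardV, h, card_empty, add_zero]
    exact dvd_mul_left _ _
  let E : Finset V → Finset (Sym2 V) := fun K => {e ∈ G.edgeFinset | ∃ v ∈ K, v ∈ e}
  have hE : ∀ K ∈ C, m.choose 2 + 1 ≤ (E K).card := by
    intro K hK
    rw [memC] at hK
    obtain ⟨x, hx, y, hy, hxy⟩ := hG.exists_adj_notMem hm (memR.mp hv₀) hK
    have hnot : s(x, y) ∉ offDiagPairs K := fun h => hy (mk_mem_offDiagPairs.mp h).2.1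
    have hsub : insert s(x, y) (offDiagPairs K) ⊆ E K := by
      apply insert_subset
      · simp only [E, mem_filter, mem_edgeFinset, mem_edgeSet]
        exact ⟨hxy, x, hx, Sym2.mem_mk_left _ _⟩
      · intro e he
        induction e with
        | h a b =>
          obtain ⟨ha, hb, hab⟩ := mk_mem_offDiagPairs.mp he
          simp only [E, mem_filter, mem_edgeFinset, mem_edgeSet]
          exact ⟨hK.1 ha hb hab, a, ha, Sym2.mem_mk_left _ _⟩
    have := card_le_card hsub
    rwa [card_insert_of_notMem hnot, card_offDiagPairs, hK.card_eq] at this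
  have hEdisj : (C : Set (Finset V)).PairwiseDisjoint E := by
    intro K hK K' hK' hne
    have hd := hCdisj hK hK' hne
    rw [Function.onFun, Finset.disjoint_left]
    intro e he he'
    simp only [E, mem_filter, mem_edgeFinset] at he he'
    obtain ⟨heG, a, ha, hae⟩ := he
    obtain ⟨-, b, hb, hbe⟩ := he'
    have hab : a ≠ b := fun h => Finset.disjoint_left.mp hd ha (h ▸ hb)
    rw [(Sym2.mem_and_mem_iff hab).mp ⟨hae, hbe⟩, mem_edgeSet] at heG
    exact hfree.not_adj (memC.mp hK) (memC.mp hK') hd ha hb heG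
  have hsum : C.card * (m.choose 2 + 1) ≤ (C.biUnion E).card := by
    rw [card_biUnion hEdisj, ← smul_eq_mul]
    exact card_nsmul_le_sum _ _ _ hE
  let ER : Finset (Sym2 V) := {e ∈ offDiagPairs R | e ∈ G.edgeSet}
  have hdisjR : Disjoint (C.biUnion E) ER := by
    rw [Finset.disjoint_left]
    intro e he he'
    simp only [E, mem_biUnion, mem_filter] at he
    obtain ⟨K, hK, -, v, hv, hve⟩ := he
    simp only [ER, offDiagPairs, mem_filter, mem_sym2_iff] at he'
    exact memR.mp (he'.1.1 v hve) K (memC.mp hK) hv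
  have hcount : (C.biUnion E).card + ER.card ≤ G.edgeSet.ncard := by
    rw [← coe_edgeFinset, Set.ncard_coe_finset, ← card_union_of_disjoint hdisjR]
    apply card_le_card
    apply union_subset
    · exact biUnion_subset.mpr fun K _ => filter_subset _ _
    · intro e he
      exact mem_edgeFinset.mpr (mem_filter.mp he).2
  refine ⟨C.card, R.card, hcardV, by omega, fun hr => ?_⟩
  have hP := card_nonadjacent_pairs_le G m R
    (by
      intro u hu v hv huv hadj
      obtain ⟨t, ht, h⟩ := hG.exists_near_clique (by omega) (memR.mp hu) (memR.mp hv) huv hadj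
      exact ⟨t, fun w hw => memR.mpr (ht w hw), h⟩)
    {e ∈ offDiagPairs R | e ∉ G.edgeSet} (filter_subset _ _) (fun e he => (mem_filter.mp he).2)
  have hsplit := card_filter_add_card_filter_not (s := offDiagPairs R) (fun e => e ∈ G.edgeSet)
  rw [card_offDiagPairs] at hsplit
  change ER.card + _ = _ at hsplit
  omega

theorem not_containsCopy_bot {α : Type*} {F : SimpleGraph α} {a b : α} (h : F.Adj a b) :
    ¬ ContainsCopy F (⊥ : SimpleGraph V) := by
  rintro ⟨f, -, hf⟩
  exact hf a b h

theorem exists_famSat3 [Finite V] {m : ℕ} (hm : 4 ≤ m) :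
    ∃ G : SimpleGraph V, FamSat3 (dumbbell m) (Vgraph m) (lambdaGraph m) G := by
  let S : Set (SimpleGraph V) := {G | ¬ ContainsCopy (dumbbell m) G ∧
    ¬ ContainsCopy (Vgraph m) G ∧ ¬ ContainsCopy (lambdaGraph m) G}
  have hbot : (⊥ : SimpleGraph V) ∈ S := by
    refine ⟨not_containsCopy_bot (a := ⟨0, by omega⟩) (b := ⟨1, by omega⟩) ?_,
      not_containsCopy_bot (a := ⟨0, by omega⟩) (b := ⟨1, by omega⟩) ?_,
      not_containsCopy_bot (a := ⟨0, by omega⟩) (b := ⟨1, by omega⟩) ?_⟩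
    · rw [dumbbell, fromRel_adj]
      simp only [ne_eq, Fin.mk.injEq]
      omega
    · rw [Vgraph, fromRel_adj]
      simp only [ne_eq, Fin.mk.injEq]
      omega
    · rw [lambdaGraph, fromRel_adj]
      simp only [ne_eq, Fin.mk.injEq]
      omega
  obtain ⟨G, hG⟩ := S.toFinite.exists_maximal ⟨⊥, hbot⟩
  refine ⟨G, hG.prop.1, hG.prop.2.1, hG.prop.2.2, fun u v huv hadj => ?_⟩
  by_contra! hno
  have hle : G ≤ addEdge G u v := le_sup_left
  exact hadj (hG.le_of_ge (y := addEdge G u v) hno hle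
    (addEdge_adj.mpr (Or.inr ⟨rfl, huv⟩)))

/-- The partition of `Fin n` into cliques on blocks of `m` consecutive vertices. -/
def blockGraph (n m : ℕ) : SimpleGraph (Fin n) where
  Adj i j := i ≠ j ∧ (i : ℕ) / m = (j : ℕ) / m
  symm := ⟨fun _ _ h => ⟨h.1.symm, h.2.symm⟩⟩
  loopless := ⟨fun _ h => h.1 rfl⟩

/-- The block with index `q`. -/
def block (n m q : ℕ) : Finset (Fin n) := {i | (i : ℕ) / m = q}

theorem mem_block {n m q : ℕ} {i : Fin n} : i ∈ block n m q ↔ (i : ℕ) / m = q := by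
  simp [block]

theorem card_block_le {n m : ℕ} (hm : 0 < m) (q : ℕ) : (block n m q).card ≤ m := by
  rw [← card_map Fin.valEmbedding]
  calc _ ≤ (Finset.Ico (q * m) (q * m + m)).card := by
        apply card_le_card
        intro i hi
        simp only [mem_map, mem_block, Fin.valEmbedding_apply] at hi
        obtain ⟨j, rfl, rfl⟩ := hi
        rw [Finset.mem_Ico]
        have := Nat.div_add_mod' (j : ℕ) m
        have := Nat.mod_lt (j : ℕ) hm
        omega
    _ = m := by simp

theorem card_block {n m : ℕ} (hm : 0 < m) (hdvd : m ∣ n) (i : Fin n) :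
    (block n m ((i : ℕ) / m)).card = m := by
  rw [← card_map Fin.valEmbedding]
  have : (block n m ((i : ℕ) / m)).map Fin.valEmbedding =
      Finset.Ico ((i : ℕ) / m * m) ((i : ℕ) / m * m + m) := by
    ext j
    simp only [mem_map, mem_block, Fin.valEmbedding_apply, Finset.mem_Ico]
    constructor
    · rintro ⟨j, hj, rfl⟩
      rw [← hj]
      have := Nat.div_add_mod' (j : ℕ) m
      have := Nat.mod_lt (j : ℕ) hm
      omega
    · intro hj
      obtain ⟨c, rfl⟩ := hdvd
      have hq : (i : ℕ) / m < c := Nat.div_lt_of_lt_mul i.2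
      have h1 : ((i : ℕ) / m + 1) * m ≤ c * m := Nat.mul_le_mul_right m hq
      rw [add_mul, one_mul, mul_comm c] at h1
      refine ⟨⟨j, by omega⟩, ?_, rfl⟩
      change j / m = (i : ℕ) / m
      rw [Nat.div_eq_iff hm]
      omega
  rw [this]
  simp

theorem isNClique_block {n m : ℕ} (hm : 0 < m) (hdvd : m ∣ n) (i : Fin n) :
    (blockGraph n m).IsNClique m (block n m ((i : ℕ) / m)) := by
  refine ⟨fun a ha b hb hab => ⟨hab, ?_⟩, card_block hm hdvd i⟩
  rw [mem_block.mp ha, mem_block.mp hb]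

theorem eq_block_of_isNClique {n m : ℕ} (hm : 0 < m) {K : Finset (Fin n)}
    (hK : (blockGraph n m).IsNClique m K) {i : Fin n} (hi : i ∈ K) :
    K = block n m ((i : ℕ) / m) := by
  apply eq_of_subset_of_card_le
  · intro j hj
    rw [mem_block]
    by_cases h : j = i
    · rw [h]
    · exact (hK.1 hj hi h).2
  · rw [hK.card_eq]
    exact card_block_le hm _

theorem mem_of_adj_blockGraph {n m : ℕ} (hm : 0 < m) {K : Finset (Fin n)}
    (hK : (blockGraph n m).IsNClique m K) {i j : Fin n} (hi : i ∈ K)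
    (hij : (blockGraph n m).Adj i j) : j ∈ K := by
  rw [eq_block_of_isNClique hm hK hi, mem_block]
  exact hij.2.symm

theorem famSat3_blockGraph {n m : ℕ} (hm : 2 ≤ m) (hdvd : m ∣ n) :
    FamSat3 (dumbbell m) (Vgraph m) (lambdaGraph m) (blockGraph n m) := by
  have hpos : 0 < m := by omega
  have hfree : FamFree m (blockGraph n m) := by
    refine ⟨?_, ?_, ?_⟩
    · intro K x x' y hK hx hx' hy hyx hyx'
      exact absurd (mem_of_adj_blockGraph hpos hK hx hyx.symm) hy
    · intro K x y z hK hx hy hz hxy hxz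
      exact absurd (mem_of_adj_blockGraph hpos hK hx hxy) hy
    · intro K K' x x' hK hK' hd hx hx' hadj
      exact Finset.disjoint_left.mp hd (mem_of_adj_blockGraph hpos hK hx hadj) hx'
  obtain ⟨hB, hV, hL⟩ := (famFree_iff hm _).mp hfree
  refine ⟨hB, hV, hL, fun u v huv hadj => Or.inl ?_⟩
  have hle : blockGraph n m ≤ addEdge (blockGraph n m) u v := le_sup_left
  refine (containsCopy_dumbbell_iff hm _).mpr ⟨_, _, u, v, (isNClique_block hpos hdvd u).mono hle,
    (isNClique_block hpos hdvd v).mono hle, ?_, mem_block.mpr rfl, mem_block.mpr rfl,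
    addEdge_adj.mpr (Or.inr ⟨rfl, huv⟩)⟩
  rw [Finset.disjoint_left]
  intro a ha hb
  exact hadj ⟨huv, (mem_block.mp ha).symm.trans (mem_block.mp hb)⟩

theorem ncard_edgeSet_blockGraph {n m : ℕ} (hm : 0 < m) (hdvd : m ∣ n) :
    (blockGraph n m).edgeSet.ncard = n / m * m.choose 2 := by
  classical
  have hdeg : ∀ v, (blockGraph n m).degree v = m - 1 := by
    intro v
    rw [← card_neighborFinset_eq_degree]
    have : (blockGraph n m).neighborFinset v = (block n m ((v : ℕ) / m)).erase v := by
      ext w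
      rw [mem_neighborFinset, mem_erase, mem_block]
      exact and_congr ne_comm eq_comm
    rw [this, card_erase_of_mem (mem_block.mpr rfl), card_block hm hdvd]
  have hsum := sum_degrees_eq_twice_card_edges (blockGraph n m)
  simp only [hdeg, sum_const, card_univ, Fintype.card_fin, smul_eq_mul] at hsum
  rw [← coe_edgeFinset, Set.ncard_coe_finset]
  obtain ⟨c, rfl⟩ := hdvd
  rw [Nat.mul_div_cancel_left _ hm]
  have h2 : m.choose 2 * 2 = m * (m - 1) := by
    rw [Nat.choose_two_right, Nat.div_mul_cancel (Nat.even_mul_pred_self m).two_dvd]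
  have : 2 * (c * m.choose 2) = 2 * (blockGraph (m * c) m).edgeFinset.card := by
    rw [← hsum, mul_comm m c, mul_assoc, ← h2]
    ring
  omega

/-- Let `m ≥ 4` and `ℱ_m = {B_{m,m}, V_m, Λ_m}`. Then (i) for every `n`
divisible by `m`, `sat(n, ℱ_m) ≤ (n/m)·C(m,2)`; and (ii) for every `n ≥ m` not divisible by
`m`, `sat(n, ℱ_m) ≥ ((n-m)/m)·(C(m,2) + 1)`. -/
theorem satFam3_bounds (m : ℕ) (hm : 4 ≤ m) :
    (∀ n : ℕ, m ∣ n →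
      satFam3 n (dumbbell m) (Vgraph m) (lambdaGraph m) ≤ n / m * m.choose 2) ∧
    (∀ n : ℕ, m ≤ n → ¬ m ∣ n →
      ((n : ℝ) - (m : ℝ)) / (m : ℝ) * ((m.choose 2 : ℝ) + 1) ≤
        (satFam3 n (dumbbell m) (Vgraph m) (lambdaGraph m) : ℝ)) := by
  constructor
  · intro n hdvd
    exact Nat.sInf_le ⟨blockGraph n m, famSat3_blockGraph (by omega) hdvd,
      ncard_edgeSet_blockGraph (by omega) hdvd⟩
  · intro n _ hdvd
    obtain ⟨G₀, hG₀⟩ := exists_famSat3 (V := Fin n) hm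
    obtain ⟨G, hG, hcard⟩ := Nat.sInf_mem (s := {e | ∃ G : SimpleGraph (Fin n),
      FamSat3 (dumbbell m) (Vgraph m) (lambdaGraph m) G ∧ G.edgeSet.ncard = e}) ⟨_, G₀, hG₀, rfl⟩
    rw [satFam3, ← hcard]
    obtain ⟨k, r, hn, h1, h2⟩ := hG.edge_lower_bound hm (by rwa [Fintype.card_fin])
    rw [Fintype.card_fin] at hn
    generalize G.edgeSet.ncard = e at h1 h2
    have hm' : (4 : ℝ) ≤ m := by exact_mod_cast hm
    have hm0 : (0 : ℝ) < m := by linarith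
    have hn' : (n : ℝ) = k * m + r := by exact_mod_cast hn
    have h1' : (k : ℝ) * (m.choose 2 + 1) ≤ e := by exact_mod_cast h1
    have hc : (0 : ℝ) < (m.choose 2 : ℝ) + 1 := by positivity
    have hsplit : ((n : ℝ) - m) / m * ((m.choose 2 : ℝ) + 1) =
        k * (m.choose 2 + 1) + (r - m) / m * (m.choose 2 + 1) := by
      rw [hn']
      field_simp
      ring
    rw [hsplit]
    rcases lt_or_ge r m with hr | hr
    · have hr' : (r : ℝ) < m := by exact_mod_cast hr
      have : ((r : ℝ) - m) / m * (m.choose 2 + 1) ≤ 0 :=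
        mul_nonpos_of_nonpos_of_nonneg
          (div_nonpos_of_nonpos_of_nonneg (by linarith) hm0.le) hc.le
      linarith
    · obtain ⟨t, rfl⟩ := Nat.exists_eq_add_of_le hr
      have h3 := h2 hr
      rw [Nat.add_sub_cancel_left] at h3
      have h3' : (k : ℝ) * (m.choose 2 + 1) + ((m + t).choose 2 : ℕ) ≤
          e + ((t + 2).choose 2 : ℕ) := by
        exact_mod_cast h3
      rw [Nat.cast_choose_two ℝ (m + t), Nat.cast_choose_two ℝ (t + 2)] at h3'
      push_cast at h3'
      have ht : (0 : ℝ) ≤ t := by positivity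
      have key : (((m + t : ℕ) : ℝ) - m) / m * (m.choose 2 + 1) ≤
          ((m : ℝ) + t) * (m + t - 1) / 2 - (t + 2) * (t + 2 - 1) / 2 := by
        rw [Nat.cast_choose_two]
        push_cast
        rw [div_mul_eq_mul_div, div_le_iff₀ hm0]
        nlinarith [mul_nonneg ht (mul_nonneg hm0.le (sub_nonneg.mpr hm')),
          mul_nonneg ht (sub_nonneg.mpr hm'), mul_nonneg hm0.le (sub_nonneg.mpr hm'),
          mul_nonneg hm0.le (mul_nonneg hm0.le (sub_nonneg.mpr hm'))]
      linarith
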